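/- arXiv:1309.6170 — 6 statements merged into one kernel-verified Lean document; each statement's English description precedes it below -/
import Mathlib

section
/- Let B be an n×n integer matrix, G an n×d integer matrix with Bᵀ·G = 0, and k ∈ {1,…,n}. Let E = E_{B,k} be the mutation matrix, and set B' = E·B·Eᵀ and G' = Eᵀ·G. Then (B')ᵀ·G' = 0. That is, mutation takes a graded seed to a graded seed. -/
open Matrix

/-- The mutation matrix `E = E_{B,k}`: `E r s = δ_{rs}` if `s ≠ k`, `E k k = -1`,
and `E r k = max 0 (-(B r k))` for `r ≠ k`. -/
def mutE {n : ℕ} (B : Matrix (Fin n) (Fin n) ℤ) (k : Fin n) : Matrix (Fin n) (Fin n) ℤ :=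
  Matrix.of fun r s =>
    if s = k then (if r = k then -1 else max 0 (-(B r k))) else (if r = s then 1 else 0)

theorem mutE_mul_self {n : ℕ} (B : Matrix (Fin n) (Fin n) ℤ) (k : Fin n) :
    mutE B k * mutE B k = 1 := by
  have key : ∀ r j, mutE B k r j = (if r = j then 1 else 0) +
      (if j = k then (if r = k then -2 else max 0 (-(B r k))) else 0) := by
    intro r j
    simp only [mutE, Matrix.of_apply]
    by_cases hj : j = k
    · subst hj
      by_cases hr : r = j <;> simp [hr]
    · simp [hj]
  ext r s
  rw [Matrix.mul_apply, Finset.sum_congr rfl (fun j _ => by rw [key r j])]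
  simp only [add_mul, ite_mul, one_mul, zero_mul, Finset.sum_add_distrib, Finset.sum_ite_eq,
    Finset.sum_ite_eq', Finset.mem_univ, if_true]
  rw [key r s, key k s, Matrix.one_apply]
  by_cases hs : s = k
  · subst hs
    by_cases hr : r = s <;> simp [hr]
  · have hs' : k ≠ s := fun h => hs h.symm
    simp [hs, hs']

/-- if `Bᵀ G = 0`, then for `B' = E B Eᵀ` and `G' = Eᵀ G` we have `(B')ᵀ G' = 0`:
mutation takes a graded seed to a graded seed. -/
theorem mutation_of_graded_seed {n d : ℕ} (B : Matrix (Fin n) (Fin n) ℤ)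
    (G : Matrix (Fin n) (Fin d) ℤ) (hG : Bᵀ * G = 0) (k : Fin n) :
    (mutE B k * B * (mutE B k)ᵀ)ᵀ * ((mutE B k)ᵀ * G) = 0 := by
  have h : (mutE B k)ᵀ * (mutE B k)ᵀ = 1 := by
    rw [← Matrix.transpose_mul, mutE_mul_self, Matrix.transpose_one]
  rw [Matrix.transpose_mul, Matrix.transpose_mul, Matrix.transpose_transpose]
  calc mutE B k * (Bᵀ * (mutE B k)ᵀ) * ((mutE B k)ᵀ * G)
      = mutE B k * (Bᵀ * (((mutE B k)ᵀ * (mutE B k)ᵀ) * G)) := by simp only [Matrix.mul_assoc]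
    _ = 0 := by rw [h, Matrix.one_mul, hG, Matrix.mul_zero]
end

section
/- Let n be odd and let B(A_n) be the n×n skew-symmetric integer matrix with B_{i,i+1} = 1 for i odd, B_{i,i+1} = −1 for i even, B_{i+1,i} = −B_{i,i+1}, and all other entries 0. Then the ℤ-submodule {v ∈ ℤ^n : B(A_n)ᵀ·v = 0} of ℤ^n is free of rank 1, generated by the vector G with G_i = 1 if i ≡ 1 (mod 4), G_i = −1 if i ≡ 3 (mod 4), and G_i = 0 if i is even. -/
open Matrix

/-- The exchange matrix of the bipartite orientation of the type `A_n` Dynkin diagram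
(0-based indices; the 1-based entry `B_{i,i+1}` is `1` for `i` odd and `-1` for `i` even,
with `B_{i+1,i} = -B_{i,i+1}` and all other entries `0`). -/
def BA (n : ℕ) : Matrix (Fin n) (Fin n) ℤ :=
  Matrix.of fun i j =>
    if (j : ℕ) = (i : ℕ) + 1 then (if (i : ℕ) % 2 = 0 then 1 else -1)
    else if (i : ℕ) = (j : ℕ) + 1 then (if (j : ℕ) % 2 = 0 then -1 else 1)
    else 0

/-- The grading vector of type `A_n`: in 1-based terms, `G_i = 1` if `i ≡ 1 (mod 4)`,
`G_i = -1` if `i ≡ 3 (mod 4)` and `G_i = 0` for `i` even; 0-based this reads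
`G_i = 1` if `i ≡ 0 (mod 4)`, `G_i = -1` if `i ≡ 2 (mod 4)`, else `0`. -/
def gA (n : ℕ) : Fin n → ℤ := fun i =>
  if (i : ℕ) % 4 = 0 then 1 else if (i : ℕ) % 4 = 2 then -1 else 0

/-- Extension of a vector by zero. -/
def extA (n : ℕ) (v : Fin n → ℤ) (k : ℕ) : ℤ := if h : k < n then v ⟨k, h⟩ else 0

lemma extA_coe (n : ℕ) (v : Fin n → ℤ) (i : Fin n) : extA n v i = v i := by
  simp [extA]

lemma extA_ge (n : ℕ) (v : Fin n → ℤ) (k : ℕ) (h : n ≤ k) : extA n v k = 0 := by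
  simp [extA, h]

lemma mulVec_BA (n : ℕ) (v : Fin n → ℤ) (j : Fin n) :
    ((BA n)ᵀ *ᵥ v) j = (if (j : ℕ) % 2 = 0 then -1 else 1) *
      ((if (j : ℕ) = 0 then 0 else extA n v ((j : ℕ) - 1)) + extA n v ((j : ℕ) + 1)) := by
  have h1 : ((BA n)ᵀ *ᵥ v) j = ∑ k ∈ Finset.range n, (
      (if k = (j : ℕ) - 1 then (if (j : ℕ) = 0 then 0 else
        (if (j : ℕ) % 2 = 0 then -1 else 1) * extA n v k) else 0)
      + (if k = (j : ℕ) + 1 then (if (j : ℕ) % 2 = 0 then -1 else 1) * extA n v k else 0)) := by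
    rw [← Fin.sum_univ_eq_sum_range (fun k : ℕ => (
      (if k = (j : ℕ) - 1 then (if (j : ℕ) = 0 then 0 else
        (if (j : ℕ) % 2 = 0 then -1 else 1) * extA n v k) else 0)
      + (if k = (j : ℕ) + 1 then (if (j : ℕ) % 2 = 0 then -1 else 1) * extA n v k else 0)))]
    simp only [Matrix.mulVec, dotProduct, Matrix.transpose_apply, BA, Matrix.of_apply, extA_coe]
    refine Finset.sum_congr rfl fun i _ => ?_
    split_ifs <;> first | omega | simp
  have hj := j.2
  rw [h1, Finset.sum_add_distrib, Finset.sum_ite_eq',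
    Finset.sum_ite_eq', if_pos (Finset.mem_range.2 (by omega))]
  by_cases h : (j : ℕ) + 1 < n
  · rw [if_pos (Finset.mem_range.2 h)]
    split_ifs <;> ring
  · rw [extA_ge n v ((j : ℕ) + 1) (by omega)]
    split_ifs <;> ring

lemma mem_ker_BA (n : ℕ) (v : Fin n → ℤ) :
    v ∈ LinearMap.ker (Matrix.mulVecLin (BA n)ᵀ) ↔ ∀ j < n,
      (if j = 0 then 0 else extA n v (j - 1)) + extA n v (j + 1) = 0 := by
  rw [LinearMap.mem_ker, Matrix.mulVecLin_apply, funext_iff]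
  simp only [mulVec_BA, Pi.zero_apply, mul_eq_zero]
  constructor
  · intro h j hj
    rcases h ⟨j, hj⟩ with h | h
    · exfalso
      revert h
      split_ifs <;> simp
    · exact h
  · intro h j
    exact Or.inr (h j j.2)

/-- for `n` odd, the ℤ-submodule `{v ∈ ℤ^n : B(A_n)ᵀ v = 0}` is free of
rank 1, generated by the vector `gA n`. -/
theorem ker_BA_odd (n : ℕ) (hn : n % 2 = 1) :
    gA n ≠ 0 ∧
    LinearMap.ker (Matrix.mulVecLin (BA n)ᵀ) = Submodule.span ℤ {gA n} := by
  refine ⟨fun h => ?_, ?_⟩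
  · have := congrFun h ⟨0, by omega⟩
    simp [gA] at this
  ext v
  rw [Submodule.mem_span_singleton, mem_ker_BA]
  constructor
  · intro h
    refine ⟨extA n v 0, ?_⟩
    have key : ∀ k, k < n → extA n v k = extA n v 0 *
        (if k % 4 = 0 then 1 else if k % 4 = 2 then -1 else 0) := by
      intro k
      induction k using Nat.strong_induction_on with
      | _ k ih =>
        intro hk
        rcases k with _ | _ | k
        · simp
        · have := h 0 (by omega)
          simpa using this
        · have h1 := h (k + 1) (by omega)
          have h2 := ih k (by omega) (by omega)
          simp only [Nat.add_sub_cancel, Nat.succ_ne_zero, if_false] at h1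
          have h3 : extA n v (k + 1 + 1) = - extA n v k := by linarith
          rw [h3, h2]
          split_ifs <;> omega
    funext i
    rw [← extA_coe n v i, key i i.2]
    simp [gA]
  · rintro ⟨a, rfl⟩ j hj
    simp only [extA, gA, Pi.smul_apply, smul_eq_mul]
    split_ifs <;> omega
end

section
/- Let n be odd and let G ∈ ℤ^n be the vector with G_i = 1 if i ≡ 1 (mod 4), G_i = −1 if i ≡ 3 (mod 4), and G_i = 0 if i is even. Let Φ ⊆ ℤ^n be the set of almost positive roots of type A_n in simple-root coordinates: Φ = {−e_i : 1 ≤ i ≤ n} ∪ {e_i + e_{i+1} + ⋯ + e_j : 1 ≤ i ≤ j ≤ n}, and for α ∈ Φ set d(α) = −Σ_{l=1}^n α_l·G_l. Then d(α) ∈ {−1, 0, 1} for every α ∈ Φ, the number of α ∈ Φ with d(α) = 1 equals (n+1)(n+3)/8, the number with d(α) = 0 equals (n−1)(n+3)/4, and the number with d(α) = −1 equals (n+1)(n+3)/8. In particular this grading of the coefficient-free type A_n cluster algebra is balanced. -/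
open Matrix

/-- The negative simple root `-e_i` in simple-root coordinates. -/
def negRoot {n : ℕ} (i : Fin n) : Fin n → ℤ := fun l => if l = i then -1 else 0

/-- The positive root `e_i + e_{i+1} + ⋯ + e_j` of type `A_n` (0-based, `i ≤ j`). -/
def intRoot {n : ℕ} (i j : Fin n) : Fin n → ℤ := fun l => if i ≤ l ∧ l ≤ j then 1 else 0

/-- The set of almost positive roots of type `A_n` in simple-root coordinates:
the negative simple roots together with the interval vectors. -/
def PhiA (n : ℕ) : Finset (Fin n → ℤ) :=
  (Finset.univ.image negRoot) ∪
    (((Finset.univ ×ˢ Finset.univ).filter (fun p : Fin n × Fin n => p.1 ≤ p.2)).image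
      (fun p => intRoot p.1 p.2))

/-- The degree `d(α) = -∑ l, α_l G_l` of the cluster variable `X[α]`. -/
def degA (n : ℕ) (α : Fin n → ℤ) : ℤ := -∑ l, α l * gA n l

/-- Partial sums of the grading vector. -/
def psA (k : ℕ) : ℤ := if k % 4 = 1 ∨ k % 4 = 2 then 1 else 0

/-- The grading vector on natural numbers. -/
def gN (k : ℕ) : ℤ := if k % 4 = 0 then 1 else if k % 4 = 2 then -1 else 0

lemma psA_succ (k : ℕ) : psA (k + 1) = psA k + gN k := by
  unfold psA gN
  split_ifs <;> omega

lemma sum_Ico_gN (i j : ℕ) (h : i ≤ j) : ∑ l ∈ Finset.Ico i j, gN l = psA j - psA i := by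
  induction j, h using Nat.le_induction with
  | base => simp
  | succ j hj ih => rw [Finset.sum_Ico_succ_top hj, ih, psA_succ]; ring

lemma degA_neg {n : ℕ} (i : Fin n) : degA n (negRoot i) = gN i := by
  have h : ∀ l, negRoot i l * gA n l = if l = i then -gA n i else 0 := by
    intro l
    by_cases h : l = i
    · subst h; simp [negRoot]
    · simp [negRoot, h]
  rw [degA, Finset.sum_congr rfl (fun l _ => h l), Finset.sum_ite_eq' ]
  simp [gA, gN]

lemma degA_int {n : ℕ} (i j : Fin n) (h : i ≤ j) :
    degA n (intRoot i j) = psA i - psA (j + 1) := by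
  have h1 : ∑ l, intRoot i j l * gA n l
      = ∑ l : Fin n, (fun l : ℕ => if (i : ℕ) ≤ l ∧ l ≤ j then gN l else 0) l := by
    apply Finset.sum_congr rfl
    intro l _
    simp only [intRoot, gA, gN, Fin.le_def, ite_mul, one_mul, zero_mul]
  have h2 : (Finset.range n).filter (fun l : ℕ => (i : ℕ) ≤ l ∧ l ≤ j)
      = Finset.Ico (i : ℕ) (j + 1) := by
    ext l
    simp only [Finset.mem_filter, Finset.mem_range, Finset.mem_Ico]
    have := j.2
    omega
  have h3 : (i : ℕ) ≤ j + 1 := by have := Fin.le_def.1 h; omega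
  rw [degA, h1, Fin.sum_univ_eq_sum_range
    (fun l : ℕ => if (i : ℕ) ≤ l ∧ l ≤ j then gN l else 0), ← Finset.sum_filter, h2, sum_Ico_gN _ _ h3]
  ring

/-- The contribution of index `j` to the count of degree `c`. -/
def wA (c : ℤ) (j : ℕ) : ℕ :=
  (∑ i ∈ Finset.range (j + 1), if psA i - psA (j + 1) = c then 1 else 0)
    + if gN j = c then 1 else 0

lemma negRoot_inj {n : ℕ} : Function.Injective (negRoot : Fin n → Fin n → ℤ) := by
  intro i j h
  have := congrFun h i
  simp only [negRoot, if_true] at this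
  by_contra hne
  simp [hne] at this

lemma intRoot_inj {n : ℕ} {i j i' j' : Fin n} (h : i ≤ j) (h' : i' ≤ j')
    (e : intRoot i j = intRoot i' j') : i = i' ∧ j = j' := by
  have key : ∀ l, (i ≤ l ∧ l ≤ j) ↔ (i' ≤ l ∧ l ≤ j') := by
    intro l
    have := congrFun e l
    simp only [intRoot] at this
    split_ifs at this <;> tauto
  have a := (key i).1 ⟨le_rfl, h⟩
  have b := (key j).1 ⟨h, le_rfl⟩
  have c := (key i').2 ⟨le_rfl, h'⟩
  have d := (key j').2 ⟨h', le_rfl⟩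
  exact ⟨le_antisymm c.1 a.1, le_antisymm b.2 d.2⟩

lemma count_eq (n : ℕ) (c : ℤ) :
    ((PhiA n).filter (fun α => degA n α = c)).card = ∑ j ∈ Finset.range n, wA c j := by
  have hd : Disjoint (Finset.univ.image (negRoot : Fin n → Fin n → ℤ))
    (((Finset.univ ×ˢ Finset.univ).filter (fun p : Fin n × Fin n => p.1 ≤ p.2)).image
      (fun p => intRoot p.1 p.2)) := by
    rw [Finset.disjoint_left]
    intro α h1 h2
    simp only [Finset.mem_image, Finset.mem_univ, true_and] at h1 h2
    obtain ⟨i, rfl⟩ := h1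
    obtain ⟨p, -, hp⟩ := h2
    have := congrFun hp i
    simp only [intRoot, negRoot, if_true] at this
    split_ifs at this <;> omega
  rw [Finset.card_filter, PhiA, Finset.sum_union hd, Finset.sum_image negRoot_inj.injOn,
    Finset.sum_image, Finset.sum_filter, Finset.sum_product_right]
  · unfold wA
    rw [Finset.sum_add_distrib, add_comm]
    congr 1
    · rw [← Fin.sum_univ_eq_sum_range
        (fun j => ∑ i ∈ Finset.range (j + 1), if psA i - psA (j + 1) = c then 1 else 0)]
      apply Finset.sum_congr rfl
      intro j _
      have h2 : (Finset.range n).filter (fun l : ℕ => l ≤ j) = Finset.range (j + 1) := by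
        ext l
        simp only [Finset.mem_filter, Finset.mem_range]
        have := j.2
        omega
      rw [← h2, Finset.sum_filter, ← Fin.sum_univ_eq_sum_range
        (fun i => if i ≤ (j : ℕ) then (if psA i - psA (j + 1) = c then 1 else 0) else 0)]
      apply Finset.sum_congr rfl
      intro i _
      by_cases h : i ≤ j
      · have h' : (i : ℕ) ≤ j := h
        simp only [h, h', if_true, degA_int i j h]
      · have h' : ¬ (i : ℕ) ≤ j := h
        simp only [h, h', if_false]
    · rw [← Fin.sum_univ_eq_sum_range (fun j => if gN j = c then 1 else 0)]
      simp only [degA_neg]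
  · intro p hp q hq e
    simp only [Finset.coe_filter, Set.mem_setOf_eq] at hp hq
    have := intRoot_inj hp.2 hq.2 e
    exact Prod.ext this.1 this.2

lemma ones_count (k : ℕ) :
    (∑ i ∈ Finset.range k, if psA i = 1 then 1 else 0) = 2 * (k / 4) + (k % 4 - 1) := by
  induction k with
  | zero => simp
  | succ k ih =>
    rw [Finset.sum_range_succ, ih]
    unfold psA
    split_ifs <;> omega

lemma zeros_count (k : ℕ) :
    (∑ i ∈ Finset.range k, if psA i = 0 then 1 else 0) = k - (2 * (k / 4) + (k % 4 - 1)) := by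
  induction k with
  | zero => simp
  | succ k ih =>
    rw [Finset.sum_range_succ, ih]
    unfold psA
    split_ifs <;> omega

lemma psA_cases (k : ℕ) : psA k = 0 ∨ psA k = 1 := by
  unfold psA
  split_ifs <;> simp

lemma wA_one (j : ℕ) : wA 1 j = (if (j + 1) % 4 = 1 ∨ (j + 1) % 4 = 2 then 0 else
    2 * ((j + 1) / 4) + ((j + 1) % 4 - 1)) + if j % 4 = 0 then 1 else 0 := by
  unfold wA
  congr 1
  · split_ifs with h
    · apply Finset.sum_eq_zero
      intro i _
      have : psA (j + 1) = 1 := by simp only [psA, h, if_true]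
      rcases psA_cases i with h' | h' <;> simp [this, h']
    · rw [← ones_count]
      have : psA (j + 1) = 0 := by simp only [psA, h, if_false]
      simp [this]
  · unfold gN
    split_ifs <;> simp_all

lemma wA_neg (j : ℕ) : wA (-1) j = (if (j + 1) % 4 = 1 ∨ (j + 1) % 4 = 2 then
    (j + 1) - (2 * ((j + 1) / 4) + ((j + 1) % 4 - 1)) else 0) + if j % 4 = 2 then 1 else 0 := by
  unfold wA
  congr 1
  · split_ifs with h
    · rw [← zeros_count]
      have : psA (j + 1) = 1 := by simp only [psA, h, if_true]
      apply Finset.sum_congr rfl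
      intro i _
      rcases psA_cases i with h' | h' <;> simp [this, h']
    · apply Finset.sum_eq_zero
      intro i _
      have : psA (j + 1) = 0 := by simp only [psA, h, if_false]
      rcases psA_cases i with h' | h' <;> simp [this, h']
  · unfold gN
    split_ifs <;> first | omega | simp_all

lemma wA_zero (j : ℕ) : wA 0 j = (if (j + 1) % 4 = 1 ∨ (j + 1) % 4 = 2 then
    2 * ((j + 1) / 4) + ((j + 1) % 4 - 1) else
    (j + 1) - (2 * ((j + 1) / 4) + ((j + 1) % 4 - 1))) + if j % 2 = 1 then 1 else 0 := by
  unfold wA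
  congr 1
  · split_ifs with h
    · rw [← ones_count]
      have : psA (j + 1) = 1 := by simp only [psA, h, if_true]
      apply Finset.sum_congr rfl
      intro i _
      rcases psA_cases i with h' | h' <;> simp [this, h']
    · rw [← zeros_count]
      have : psA (j + 1) = 0 := by simp only [psA, h, if_false]
      simp [this]
  · unfold gN
    split_ifs <;> first | omega | simp_all

lemma sum_one (q : ℕ) : ∑ j ∈ Finset.range (4 * q + 1), wA 1 j = (2 * q + 1) * (q + 1) ∧
    ∑ j ∈ Finset.range (4 * q + 3), wA 1 j = (2 * q + 3) * (q + 1) := by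
  have a : ∀ q, wA 1 (4 * q + 1) = 0 := by intro q; rw [wA_one]; split_ifs <;> omega
  have b : ∀ q, wA 1 (4 * q + 2) = 2 * q + 2 := by intro q; rw [wA_one]; split_ifs <;> omega
  have c : ∀ q, wA 1 (4 * q + 3) = 2 * q + 2 := by intro q; rw [wA_one]; split_ifs <;> omega
  have d : ∀ q, wA 1 (4 * q + 4) = 1 := by intro q; rw [wA_one]; split_ifs <;> omega
  have e : ∑ j ∈ Finset.range (4 * q + 1), wA 1 j = (2 * q + 1) * (q + 1) := by
    induction q with
    | zero => simp [wA_one]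
    | succ q ih =>
      rw [show 4 * (q + 1) + 1 = 4 * q + 1 + 1 + 1 + 1 + 1 by ring]
      simp only [Finset.sum_range_succ _ (4 * q + 1 + 1 + 1 + 1),
        Finset.sum_range_succ _ (4 * q + 1 + 1 + 1), Finset.sum_range_succ _ (4 * q + 1 + 1),
        Finset.sum_range_succ _ (4 * q + 1), ih, add_assoc, Nat.reduceAdd, a, b, c, d]
      ring
  refine ⟨e, ?_⟩
  rw [Finset.sum_range_succ _ (4 * q + 2), Finset.sum_range_succ _ (4 * q + 1), e, a, b]
  ring

lemma sum_neg (q : ℕ) : ∑ j ∈ Finset.range (4 * q + 1), wA (-1) j = (2 * q + 1) * (q + 1) ∧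
    ∑ j ∈ Finset.range (4 * q + 3), wA (-1) j = (2 * q + 3) * (q + 1) := by
  have a : ∀ q, wA (-1) (4 * q + 1) = 2 * q + 1 := by
    intro q; rw [wA_neg]; split_ifs <;> omega
  have b : ∀ q, wA (-1) (4 * q + 2) = 1 := by intro q; rw [wA_neg]; split_ifs <;> omega
  have c : ∀ q, wA (-1) (4 * q + 3) = 0 := by intro q; rw [wA_neg]; split_ifs <;> omega
  have d : ∀ q, wA (-1) (4 * q + 4) = 2 * q + 3 := by
    intro q; rw [wA_neg]; split_ifs <;> omega
  have e : ∑ j ∈ Finset.range (4 * q + 1), wA (-1) j = (2 * q + 1) * (q + 1) := by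
    induction q with
    | zero => simp [wA_neg]
    | succ q ih =>
      rw [show 4 * (q + 1) + 1 = 4 * q + 1 + 1 + 1 + 1 + 1 by ring]
      simp only [Finset.sum_range_succ _ (4 * q + 1 + 1 + 1 + 1),
        Finset.sum_range_succ _ (4 * q + 1 + 1 + 1), Finset.sum_range_succ _ (4 * q + 1 + 1),
        Finset.sum_range_succ _ (4 * q + 1), ih, add_assoc, Nat.reduceAdd, a, b, c, d]
      ring
  refine ⟨e, ?_⟩
  rw [Finset.sum_range_succ _ (4 * q + 2), Finset.sum_range_succ _ (4 * q + 1), e, a, b]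
  ring

lemma sum_zero_deg (q : ℕ) : ∑ j ∈ Finset.range (4 * q + 1), wA 0 j = 4 * q * (q + 1) ∧
    ∑ j ∈ Finset.range (4 * q + 3), wA 0 j = (2 * q + 1) * (2 * q + 3) := by
  have a : ∀ q, wA 0 (4 * q + 1) = 2 * q + 2 := by
    intro q; rw [wA_zero]; split_ifs <;> omega
  have b : ∀ q, wA 0 (4 * q + 2) = 2 * q + 1 := by
    intro q; rw [wA_zero]; split_ifs <;> omega
  have c : ∀ q, wA 0 (4 * q + 3) = 2 * q + 3 := by
    intro q; rw [wA_zero]; split_ifs <;> omega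
  have d : ∀ q, wA 0 (4 * q + 4) = 2 * q + 2 := by
    intro q; rw [wA_zero]; split_ifs <;> omega
  have e : ∑ j ∈ Finset.range (4 * q + 1), wA 0 j = 4 * q * (q + 1) := by
    induction q with
    | zero => simp [wA_zero]
    | succ q ih =>
      rw [show 4 * (q + 1) + 1 = 4 * q + 1 + 1 + 1 + 1 + 1 by ring]
      simp only [Finset.sum_range_succ _ (4 * q + 1 + 1 + 1 + 1),
        Finset.sum_range_succ _ (4 * q + 1 + 1 + 1), Finset.sum_range_succ _ (4 * q + 1 + 1),
        Finset.sum_range_succ _ (4 * q + 1), ih, add_assoc, Nat.reduceAdd, a, b, c, d]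
      ring
  refine ⟨e, ?_⟩
  rw [Finset.sum_range_succ _ (4 * q + 2), Finset.sum_range_succ _ (4 * q + 1), e, a, b]
  ring

/-- for `n` odd, all degrees lie in `{-1, 0, 1}`; there are
`(n+1)(n+3)/8` almost positive roots of degree `1`, `(n-1)(n+3)/4` of degree `0` and
`(n+1)(n+3)/8` of degree `-1`.  In particular the grading is balanced. -/
theorem degree_distribution_A (n : ℕ) (hn : n % 2 = 1) :
    (∀ α ∈ PhiA n, degA n α ∈ ({-1, 0, 1} : Set ℤ)) ∧
    ((PhiA n).filter (fun α => degA n α = 1)).card = (n + 1) * (n + 3) / 8 ∧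
    ((PhiA n).filter (fun α => degA n α = 0)).card = (n - 1) * (n + 3) / 4 ∧
    ((PhiA n).filter (fun α => degA n α = -1)).card = (n + 1) * (n + 3) / 8 := by
  refine ⟨?_, ?_⟩
  · intro α hα
    simp only [PhiA, Finset.mem_union, Finset.mem_image, Finset.mem_univ, true_and,
      Finset.mem_filter, Finset.mem_product] at hα
    simp only [Set.mem_insert_iff, Set.mem_singleton_iff]
    rcases hα with ⟨i, rfl⟩ | ⟨p, hp, rfl⟩
    · rw [degA_neg]
      unfold gN
      split_ifs <;> simp
    · rw [degA_int _ _ hp]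
      rcases psA_cases p.1 with h | h <;> rcases psA_cases (p.2 + 1) with h' | h' <;>
        simp [h, h']
  · rw [count_eq, count_eq, count_eq]
    obtain ⟨q, rfl | rfl⟩ : ∃ q, n = 4 * q + 1 ∨ n = 4 * q + 3 := ⟨n / 4, by omega⟩
    · rw [(sum_one q).1, (sum_neg q).1, (sum_zero_deg q).1]
      have h1 : (4 * q + 1 + 1) * (4 * q + 1 + 3) = 8 * ((2 * q + 1) * (q + 1)) := by ring
      have h2 : (4 * q + 1 - 1) * (4 * q + 1 + 3) = 4 * (4 * q * (q + 1)) := by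
        rw [Nat.add_sub_cancel]; ring
      rw [h1, h2]
      omega
    · rw [(sum_one q).2, (sum_neg q).2, (sum_zero_deg q).2]
      have h1 : (4 * q + 3 + 1) * (4 * q + 3 + 3) = 8 * ((2 * q + 3) * (q + 1)) := by ring
      have h2 : (4 * q + 3 - 1) * (4 * q + 3 + 3) = 4 * ((2 * q + 1) * (2 * q + 3)) := by
        rw [show 4 * q + 3 - 1 = 4 * q + 2 by omega]; ring
      rw [h1, h2]
      omega
end

section
/- Let n ≥ 3 be odd and let B(C_n) be the n×n integer matrix with B_{i,i+1} = 1 for i odd, B_{i,i+1} = −1 for i even (1 ≤ i ≤ n−2), B_{i+1,i} = −B_{i,i+1} for 1 ≤ i ≤ n−2, B_{n−1,n} = −2, B_{n,n−1} = 1, and all other entries 0. Then B(C_n) has rank n−1 over ℚ, and the ℤ-submodule {v ∈ ℤ^n : B(C_n)ᵀ·v = 0} is free of rank 1, generated by the vector G with G_i = (−1)^{(i−1)/2} for i odd (including i = n) and G_i = 0 for i even. -/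
open Matrix

/-- The exchange matrix of the bipartite seed of type `C_n` (0-based indices): in 1-based
terms, `B_{i,i+1} = 1` for `i` odd, `B_{i,i+1} = -1` for `i` even (`i ≤ n-2`),
`B_{i+1,i} = -B_{i,i+1}` for `i ≤ n-2`, `B_{n-1,n} = -2`, `B_{n,n-1} = 1`, all other
entries `0`. -/
def BC (n : ℕ) : Matrix (Fin n) (Fin n) ℤ :=
  Matrix.of fun i j =>
    if (j : ℕ) = (i : ℕ) + 1 then
      (if (j : ℕ) = n - 1 then -2 else (if (i : ℕ) % 2 = 0 then 1 else -1))
    else if (i : ℕ) = (j : ℕ) + 1 then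
      (if (i : ℕ) = n - 1 then 1 else (if (j : ℕ) % 2 = 0 then -1 else 1))
    else 0

/-- The type `C_n` grading vector: in 1-based terms, `G_i = (-1)^((i-1)/2)` for `i` odd
(including `i = n`) and `G_i = 0` for `i` even. -/
def gC (n : ℕ) : Fin n → ℤ := fun i =>
  if (i : ℕ) % 4 = 0 then 1 else if (i : ℕ) % 4 = 2 then -1 else 0

theorem BC_col_zero {R : Type*} [CommRing R] (n : ℕ) (hn3 : 3 ≤ n) (v : Fin n → R) :
    ∑ i, ((BC n i ⟨0, by omega⟩ : ℤ) : R) * v i = - v ⟨1, by omega⟩ := by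
  rw [Fintype.sum_eq_single (⟨1, by omega⟩ : Fin n)]
  · have h : ¬ (1 = n - 1) := by omega
    simp [BC, h]
  · intro x hx
    have h : (x : ℕ) ≠ 1 := fun h => hx (Fin.ext h)
    simp [BC, h]

theorem BC_col_last {R : Type*} [CommRing R] (n : ℕ) (hn3 : 3 ≤ n) (v : Fin n → R) :
    ∑ i, ((BC n i ⟨n - 1, by omega⟩ : ℤ) : R) * v i = - 2 * v ⟨n - 2, by omega⟩ := by
  rw [Fintype.sum_eq_single (⟨n - 2, by omega⟩ : Fin n)]
  · have h : n - 1 = n - 2 + 1 := by omega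
    simp [BC, ← h]
  · intro x hx
    have h : (x : ℕ) ≠ n - 2 := fun h => hx (Fin.ext h)
    have h1 : ¬ (n - 1 = (x : ℕ) + 1) := by omega
    have h2 : ¬ ((x : ℕ) = n - 1 + 1) := by omega
    simp [BC, h1, h2]

theorem BC_col_mid {R : Type*} [CommRing R] (n : ℕ) (hn : n % 2 = 1) (v : Fin n → R)
    (k : ℕ) (hk : k + 2 < n) :
    ∑ i, ((BC n i ⟨k + 1, by omega⟩ : ℤ) : R) * v i =
      (if k % 2 = 0 then 1 else -1) * (v ⟨k, by omega⟩ + v ⟨k + 2, hk⟩) := by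
  rw [Fintype.sum_eq_add (⟨k, by omega⟩ : Fin n) ⟨k + 2, hk⟩]
  · have h : ¬ (k + 1 = n - 1) := by omega
    have h3 : ¬ (k + 1 = k + 2 + 1) := by omega
    rcases Nat.mod_two_eq_zero_or_one k with h0 | h0
    · have h1 : (k + 1) % 2 = 1 := by omega
      simp [BC, h, h0, h1]
    · have h1 : (k + 1) % 2 = 0 := by omega
      have h2 : ¬ (k + 2 = n - 1) := by omega
      simp [BC, h, h0, h1, h2]
      ring
  · simp [Fin.ext_iff]
  · rintro x ⟨hx, hx'⟩
    have h : (x : ℕ) ≠ k := fun h => hx (Fin.ext h)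
    have h' : (x : ℕ) ≠ k + 2 := fun h => hx' (Fin.ext h)
    have h1 : ¬ (k + 1 = (x : ℕ) + 1) := by omega
    have h2 : ¬ ((x : ℕ) = k + 1 + 1) := by omega
    simp only [BC, Matrix.of_apply, h1, h2, if_false, Int.cast_zero, zero_mul]

theorem BC_ker_iff {R : Type*} [CommRing R] (n : ℕ) (hn3 : 3 ≤ n) (hn : n % 2 = 1)
    (v : Fin n → R) :
    (∀ j, ∑ i, ((BC n i j : ℤ) : R) * v i = 0) ↔
      ∃ c : R, ∀ i, v i = c * (gC n i : ℤ) := by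
  constructor
  · intro h
    have h0 := h ⟨0, by omega⟩
    rw [BC_col_zero n hn3] at h0
    have hm : ∀ (k : ℕ) (hk : k + 2 < n), v ⟨k + 2, hk⟩ = - v ⟨k, by omega⟩ := by
      intro k hk
      have := h ⟨k + 1, by omega⟩
      rw [BC_col_mid n hn v k hk] at this
      split_ifs at this
      · linear_combination this
      · linear_combination -this
    refine ⟨v ⟨0, by omega⟩, ?_⟩
    rintro ⟨k, hk⟩
    induction k using Nat.strong_induction_on with
    | _ k ih =>
      match k, hk, ih with
      | 0, hk, ih => simp [gC]
      | 1, hk, ih => simpa [gC] using h0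
      | k + 2, hk, ih =>
        rw [hm k hk, ih k (by omega) (by omega)]
        have : gC n ⟨k + 2, hk⟩ = - gC n ⟨k, by omega⟩ := by
          simp only [gC]; split_ifs <;> omega
        rw [this]; push_cast; ring
  · rintro ⟨c, hc⟩ ⟨j, hj⟩
    rcases j with _ | k
    · rw [BC_col_zero n hn3, hc]; simp [gC]
    · by_cases hk : k + 2 < n
      · rw [BC_col_mid n hn v k hk, hc, hc]
        have : gC n ⟨k + 2, hk⟩ = - gC n ⟨k, by omega⟩ := by
          simp only [gC]; split_ifs <;> omega
        rw [this]; push_cast; ring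
      · have e : (⟨k + 1, hj⟩ : Fin n) = ⟨n - 1, by omega⟩ := Fin.ext (by simp; omega)
        rw [e, BC_col_last n hn3, hc]
        have : gC n ⟨n - 2, by omega⟩ = 0 := by
          simp only [gC]; split_ifs <;> omega
        rw [this]; simp

theorem BC_ker {R : Type*} [CommRing R] (n : ℕ) (hn3 : 3 ≤ n) (hn : n % 2 = 1) :
    LinearMap.ker (Matrix.mulVecLin ((BC n).map ((↑) : ℤ → R))ᵀ) =
      Submodule.span R {fun i => ((gC n i : ℤ) : R)} := by
  ext v
  rw [LinearMap.mem_ker, Submodule.mem_span_singleton]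
  have := BC_ker_iff n hn3 hn v
  simp only [funext_iff, Matrix.mulVecLin_apply, Matrix.mulVec, dotProduct,
    Matrix.transpose_apply, Matrix.map_apply, Pi.zero_apply, Pi.smul_apply, smul_eq_mul]
  rw [this]
  simp only [eq_comm]

/-- for odd `n ≥ 3`, the matrix `B(C_n)` has rank `n - 1` over ℚ and the
ℤ-submodule `{v ∈ ℤ^n : B(C_n)ᵀ v = 0}` is free of rank 1, generated by `gC n`. -/
theorem ker_BC_odd (n : ℕ) (hn3 : 3 ≤ n) (hn : n % 2 = 1) :
    ((BC n).map ((↑) : ℤ → ℚ)).rank = n - 1 ∧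
    gC n ≠ 0 ∧
    LinearMap.ker (Matrix.mulVecLin (BC n)ᵀ) = Submodule.span ℤ {gC n} := by
  refine ⟨?_, ?_, ?_⟩
  · rw [← Matrix.rank_transpose, Matrix.rank]
    have h := LinearMap.finrank_range_add_finrank_ker
      (Matrix.mulVecLin ((BC n).map ((↑) : ℤ → ℚ))ᵀ)
    rw [BC_ker n hn3 hn, finrank_span_singleton, Module.finrank_fin_fun] at h
    · omega
    · intro h0
      have := congrFun h0 ⟨0, by omega⟩
      simp [gC] at this
  · intro h0
    have := congrFun h0 ⟨0, by omega⟩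
    simp [gC] at this
  · have := BC_ker (R := ℤ) n hn3 hn
    have e : (BC n).map (Int.cast : ℤ → ℤ) = BC n := by ext i j; simp
    rw [e] at this
    exact this
end

section
/- For n ≥ 4, let B(D_n) be the n×n skew-symmetric integer matrix of the following orientation of the type D_n Dynkin diagram: B_{i,i+1} = 1 for i odd and B_{i,i+1} = −1 for i even (1 ≤ i ≤ n−3), B_{n−2,n−1} = B_{n−2,n} = s where s = 1 if n−2 is odd and s = −1 if n−2 is even, with B_{ji} = −B_{ij} throughout and all other entries 0. Then the rank of B(D_n) over ℚ equals n−1 if n is odd and n−2 if n is even; moreover when n is odd the ℤ-submodule {v ∈ ℤ^n : B(D_n)·v = 0} is free of rank 1, generated by the vector (0, 0, …, 0, 1, −1). -/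
open Matrix

/-- The exchange matrix of the given orientation of the type `D_n` Dynkin diagram
(0-based indices; 1-based chain `1—2—⋯—(n-2)` with fork vertices `n-1` and `n` joined to
`n-2`): in 1-based terms, `B_{i,i+1} = 1` for `i` odd, `-1` for `i` even (`i ≤ n-3`),
`B_{n-2,n-1} = B_{n-2,n} = s` with `s = 1` if `n-2` is odd and `s = -1` if `n-2` is even,
`B_{ji} = -B_{ij}` throughout, and all other entries `0`. -/
def BD (n : ℕ) : Matrix (Fin n) (Fin n) ℤ :=
  Matrix.of fun i j =>
    if (j : ℕ) = (i : ℕ) + 1 ∧ (j : ℕ) ≤ n - 2 then (if (i : ℕ) % 2 = 0 then 1 else -1)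
    else if (i : ℕ) = (j : ℕ) + 1 ∧ (i : ℕ) ≤ n - 2 then (if (j : ℕ) % 2 = 0 then -1 else 1)
    else if (i : ℕ) = n - 3 ∧ (j : ℕ) = n - 1 then (if (n - 3) % 2 = 0 then 1 else -1)
    else if (i : ℕ) = n - 1 ∧ (j : ℕ) = n - 3 then (if (n - 3) % 2 = 0 then -1 else 1)
    else 0

/-- The type `D_n` grading vector `(0, 0, …, 0, 1, -1)`. -/
def gD (n : ℕ) : Fin n → ℤ := fun i =>
  if (i : ℕ) = n - 2 then 1 else if (i : ℕ) = n - 1 then -1 else 0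

/-- Extension by zero of a vector to all natural indices. -/
def extW {R : Type*} [CommRing R] {n : ℕ} (v : Fin n → R) (k : ℕ) : R :=
  if h : k < n then v ⟨k, h⟩ else 0

theorem extW_val {R : Type*} [CommRing R] {n : ℕ} (v : Fin n → R) (i : Fin n) :
    extW v (i : ℕ) = v i := by
  simp [extW]

/-- Row equation of the adjacency matrix. -/
theorem BD_row {R : Type*} [CommRing R] (m : ℕ) (v : Fin (m + 4) → R) (i : Fin (m + 4)) :
    ∃ s : R, s * s = 1 ∧ (((BD (m + 4)).map ((↑) : ℤ → R)) *ᵥ v) i =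
      s * ((if (i : ℕ) + 1 ≤ m + 2 then extW v (i + 1) else 0)
        + (if 1 ≤ (i : ℕ) ∧ (i : ℕ) ≤ m + 2 then extW v (i - 1) else 0)
        + (if (i : ℕ) = m + 1 then extW v (m + 3) else 0)
        + (if (i : ℕ) = m + 3 then extW v (m + 1) else 0)) := by
  refine ⟨if (i : ℕ) = m + 3 then (if (m + 1) % 2 = 0 then -1 else 1)
    else (if (i : ℕ) % 2 = 0 then 1 else -1), by split_ifs <;> simp, ?_⟩
  set s : R := if (i : ℕ) = m + 3 then (if (m + 1) % 2 = 0 then -1 else 1)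
    else (if (i : ℕ) % 2 = 0 then 1 else -1) with hs
  have key : ∀ j : Fin (m + 4), (((BD (m + 4)) i j : ℤ) : R) * v j =
      s * ((if (j : ℕ) = (i : ℕ) + 1 then (if (i : ℕ) + 1 ≤ m + 2 then extW v (i + 1) else 0) else 0)
        + (if (j : ℕ) = (i : ℕ) - 1 then
            (if 1 ≤ (i : ℕ) ∧ (i : ℕ) ≤ m + 2 then extW v (i - 1) else 0) else 0)
        + (if (j : ℕ) = m + 3 then (if (i : ℕ) = m + 1 then extW v (m + 3) else 0) else 0)
        + (if (j : ℕ) = m + 1 then (if (i : ℕ) = m + 3 then extW v (m + 1) else 0) else 0)) := by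
    intro j
    rw [← extW_val v j, hs]
    obtain ⟨i, hi⟩ := i
    obtain ⟨j, hj⟩ := j
    simp only [BD, Matrix.of_apply, show m + 4 - 2 = m + 2 by omega,
      show m + 4 - 3 = m + 1 by omega, show m + 4 - 1 = m + 3 by omega]
    by_cases h1 : j = i + 1
    · subst h1
      by_cases h2 : i + 1 ≤ m + 2
      · have a1 : i ≠ m + 3 := by omega
        have a2 : ¬ (i + 1 = i - 1) := by omega
        have a3 : i + 1 ≠ m + 3 := by omega
        have a4 : i ≠ m + 2 := by omega
        simp [h2, a1, a2, a3, a4]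
      · have a0 : i = m + 2 := by omega
        subst a0
        simp
    · by_cases h2 : i = j + 1
      · subst h2
        by_cases h3 : j + 1 ≤ m + 2
        · have a1 : j ≠ m + 2 := by omega
          have a2 : j ≠ m + 3 := by omega
          have a3 : j ≤ m + 1 := by omega
          have a5 : j ≠ j + 1 + 1 := by omega
          rcases Nat.mod_two_eq_zero_or_one j with h | h
          · have : (j + 1) % 2 = 1 := by omega
            simp [a1, a2, a3, a5, h, this]
          · have : (j + 1) % 2 = 0 := by omega
            simp [a1, a2, a3, a5, h, this]
        · have a0 : j = m + 2 := by omega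
          subst a0
          simp
      · have a1 : ¬ (j = i - 1 ∧ 1 ≤ i) := by omega
        by_cases h3 : i = m + 1 ∧ j = m + 3
        · obtain ⟨rfl, rfl⟩ := h3
          simp
        · by_cases h4 : i = m + 3 ∧ j = m + 1
          · obtain ⟨rfl, rfl⟩ := h4
            simp
          · simp only [h1, h2, h3, h4, false_and, if_false]
            split_ifs <;> first | omega | simp
  have S : ∀ (k : ℕ) (c : R), (k < m + 4 ∨ c = 0) →
      ∑ j : Fin (m + 4), (if (j : ℕ) = k then c else 0) = c := by
    intro k c h
    rcases h with h | h
    · rw [Finset.sum_eq_single ⟨k, h⟩]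
      · simp
      · intro b _ hb
        rw [if_neg]
        intro h'
        exact hb (Fin.ext h')
      · simp
    · simp [h]
  have hi := i.2
  simp only [Matrix.mulVec, dotProduct, Matrix.map_apply, key]
  rw [← Finset.mul_sum]
  simp only [Finset.sum_add_distrib]
  rw [S, S, S, S]
  · left; omega
  · left; omega
  · left; omega
  · by_cases h : (i : ℕ) + 1 ≤ m + 2
    · left; omega
    · right; simp [h]

theorem BD_ker {R : Type*} [CommRing R] (m : ℕ) (v : Fin (m + 4) → R) :
    ((BD (m + 4)).map ((↑) : ℤ → R)) *ᵥ v = 0 ↔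
      extW v 1 = 0 ∧ (∀ i, i < m → extW v i + extW v (i + 2) = 0) ∧
      extW v m + extW v (m + 2) + extW v (m + 3) = 0 ∧ extW v (m + 1) = 0 := by
  have hrow : ∀ i : Fin (m + 4), (((BD (m + 4)).map ((↑) : ℤ → R)) *ᵥ v) i = 0 ↔
      ((if (i : ℕ) + 1 ≤ m + 2 then extW v (i + 1) else 0)
        + (if 1 ≤ (i : ℕ) ∧ (i : ℕ) ≤ m + 2 then extW v (i - 1) else 0)
        + (if (i : ℕ) = m + 1 then extW v (m + 3) else 0)
        + (if (i : ℕ) = m + 3 then extW v (m + 1) else 0)) = 0 := by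
    intro i
    obtain ⟨s, hs, h⟩ := BD_row m v i
    rw [h]
    exact (IsUnit.of_mul_eq_one s hs).mul_right_eq_zero
  rw [funext_iff]
  simp only [Pi.zero_apply, hrow]
  constructor
  · intro H
    refine ⟨?_, ?_, ?_, ?_⟩
    · simpa using H ⟨0, by omega⟩
    · intro i hi
      have := H ⟨i + 1, by omega⟩
      have a1 : i + 1 + 1 ≤ m + 2 := by omega
      have a2 : i + 1 ≤ m + 2 := by omega
      have a3 : i + 1 ≠ m + 1 := by omega
      have a4 : i + 1 ≠ m + 3 := by omega
      simp only [a1, a2, a3, a4, if_true, if_false] at this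
      simp at this
      rw [← this]; ring
    · have := H ⟨m + 1, by omega⟩
      simp at this
      rw [← this]; ring
    · simpa using H ⟨m + 3, by omega⟩
  · rintro ⟨h1, h2, h3, h4⟩ ⟨i, hi⟩
    simp only
    rcases Nat.eq_zero_or_pos i with rfl | hp
    · simp [h1]
    · obtain ⟨k, rfl⟩ : ∃ k, i = k + 1 := ⟨i - 1, by omega⟩
      rcases lt_trichotomy k m with hk | hk | hk
      · have a1 : k + 1 + 1 ≤ m + 2 := by omega
        have a2 : k + 1 ≤ m + 2 := by omega
        have a3 : k + 1 ≠ m + 1 := by omega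
        have a4 : k + 1 ≠ m + 3 := by omega
        simp only [a1, a2, a3, a4, if_true, if_false]
        have := h2 k hk
        simp
        rw [← this]; ring
      · subst hk
        simp
        rw [← h3]; ring
      · have : k = m + 1 ∨ k = m + 2 := by omega
        rcases this with rfl | rfl
        · simp [h4]
        · simp [h4]

/-- The grading vector over a general ring. -/
def gR (R : Type*) [CommRing R] (m : ℕ) : Fin (m + 4) → R := fun i =>
  if (i : ℕ) = m + 2 then 1 else if (i : ℕ) = m + 3 then -1 else 0

/-- The second kernel vector, for `n` even. -/
def hR (R : Type*) [CommRing R] (m : ℕ) : Fin (m + 4) → R := fun i =>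
  if (i : ℕ) = m + 2 then 0 else if (i : ℕ) = m + 3 then - (-1) ^ (m / 2)
    else if (i : ℕ) % 2 = 0 then (-1) ^ ((i : ℕ) / 2) else 0

theorem extW_gR (R : Type*) [CommRing R] (m k : ℕ) : extW (gR R m) k =
    if k = m + 2 then 1 else if k = m + 3 then -1 else 0 := by
  unfold extW gR
  split_ifs <;> first | rfl | omega

theorem extW_hR (R : Type*) [CommRing R] (m k : ℕ) (hk : k < m + 4) : extW (hR R m) k =
    if k = m + 2 then 0 else if k = m + 3 then - (-1) ^ (m / 2)
    else if k % 2 = 0 then (-1) ^ (k / 2) else 0 := by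
  simp [extW, hR, hk]

theorem gR_mem (R : Type*) [CommRing R] (m : ℕ) :
    ((BD (m + 4)).map ((↑) : ℤ → R)) *ᵥ (gR R m) = 0 := by
  rw [BD_ker]
  simp only [extW_gR]
  refine ⟨by simp, ?_, by simp, by simp⟩
  intro i hi
  have a1 : i ≠ m + 2 := by omega
  have a2 : i ≠ m + 3 := by omega
  have a3 : i ≠ m := by omega
  have a4 : i ≠ m + 1 := by omega
  simp [a1, a2, a3, a4]

theorem hR_mem (R : Type*) [CommRing R] (m : ℕ) (hm : m % 2 = 0) :
    ((BD (m + 4)).map ((↑) : ℤ → R)) *ᵥ (hR R m) = 0 := by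
  rw [BD_ker]
  refine ⟨?_, ?_, ?_, ?_⟩
  · rw [extW_hR _ _ _ (by omega)]
    simp
  · intro i hi
    rw [extW_hR _ _ _ (by omega), extW_hR _ _ _ (by omega)]
    have a1 : i ≠ m + 2 := by omega
    have a2 : i ≠ m + 3 := by omega
    have a3 : i ≠ m := by omega
    have a4 : i + 2 ≠ m + 3 := by omega
    have a5 : (i + 2) / 2 = i / 2 + 1 := by omega
    simp only [a1, a2, a4, a5, Nat.add_mod_right, if_false]
    rw [if_neg (show ¬ (i + 2 = m + 2) by omega)]
    split_ifs
    · ring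
    · simp
  · rw [extW_hR _ _ _ (by omega), extW_hR _ _ _ (by omega), extW_hR _ _ _ (by omega)]
    simp [hm]
  · rw [extW_hR _ _ _ (by omega)]
    have : (m + 1) % 2 = 1 := by omega
    simp [this]

theorem up_chain {R : Type*} [CommRing R] (m : ℕ) (W : ℕ → R)
    (h : ∀ i, i < m → W i + W (i + 2) = 0) (a : ℕ) :
    ∀ k, a + 2 * k < m + 2 → W (a + 2 * k) = (-1) ^ k * W a := by
  intro k
  induction k with
  | zero => simp
  | succ k ih =>
    intro hk
    have h1 := ih (by omega)
    have h2 := h (a + 2 * k) (by omega)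
    rw [show a + 2 * (k + 1) = a + 2 * k + 2 by ring, pow_succ]
    linear_combination h2 - h1

theorem ker_odd {R : Type*} [CommRing R] (m : ℕ) (hm : m % 2 = 1) (v : Fin (m + 4) → R)
    (hv : ((BD (m + 4)).map ((↑) : ℤ → R)) *ᵥ v = 0) :
    v = extW v (m + 2) • gR R m := by
  rw [BD_ker] at hv
  obtain ⟨h1, h2, h3, h4⟩ := hv
  have up := up_chain m (extW v) h2
  have z0 : extW v 0 = 0 := by
    have := up 0 ((m + 1) / 2) (by omega)
    rw [show 0 + 2 * ((m + 1) / 2) = m + 1 by omega, h4] at this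
    have h5 : ((-1 : R) ^ ((m + 1) / 2)) * (-1 : R) ^ ((m + 1) / 2) = 1 := by
      rw [← mul_pow]; simp
    linear_combination (-extW v 0) * h5 - (-1 : R) ^ ((m + 1) / 2) * this
  have z : ∀ k, k < m + 2 → extW v k = 0 := by
    intro k hk
    rcases Nat.mod_two_eq_zero_or_one k with h | h
    · have := up 0 (k / 2) (by omega)
      rw [show 0 + 2 * (k / 2) = k by omega, z0] at this
      simpa using this
    · have := up 1 (k / 2) (by omega)
      rw [show 1 + 2 * (k / 2) = k by omega, h1] at this
      simpa using this
  have zm := z m (by omega)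
  ext i
  have hi := i.2
  rw [← extW_val v i]
  simp only [Pi.smul_apply, gR, smul_eq_mul]
  split_ifs with a b
  · rw [a]; simp
  · rw [b]
    linear_combination h3 - zm
  · rw [z _ (by omega)]; simp

theorem ker_even {R : Type*} [CommRing R] (m : ℕ) (hm : m % 2 = 0) (v : Fin (m + 4) → R)
    (hv : ((BD (m + 4)).map ((↑) : ℤ → R)) *ᵥ v = 0) :
    extW v (m + 2) • gR R m + extW v 0 • hR R m = v := by
  rw [BD_ker] at hv
  obtain ⟨h1, h2, h3, h4⟩ := hv
  have up := up_chain m (extW v) h2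
  have zm := up 0 (m / 2) (by omega)
  rw [show 0 + 2 * (m / 2) = m by omega] at zm
  ext i
  have hi := i.2
  rw [← extW_val v i]
  simp only [Pi.smul_apply, Pi.add_apply, gR, hR, smul_eq_mul]
  split_ifs with a b c
  · rw [a]; simp
  · rw [b]
    linear_combination zm - h3
  · have := up 0 ((i : ℕ) / 2) (by omega)
    rw [show 0 + 2 * ((i : ℕ) / 2) = i by omega] at this
    rw [this]; ring
  · have := up 1 ((i : ℕ) / 2) (by omega)
    rw [show 1 + 2 * ((i : ℕ) / 2) = i by omega] at this
    rw [this, h1]; ring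

theorem gD_eq (m : ℕ) : gD (m + 4) = gR ℤ m := by
  ext i
  simp [gD, gR]

theorem ker_odd_span (R : Type*) [CommRing R] (m : ℕ) (hm : m % 2 = 1) :
    LinearMap.ker (Matrix.mulVecLin ((BD (m + 4)).map ((↑) : ℤ → R))) =
      Submodule.span R {gR R m} := by
  ext v
  rw [LinearMap.mem_ker, Matrix.mulVecLin_apply, Submodule.mem_span_singleton]
  constructor
  · intro h
    exact ⟨_, (ker_odd m hm v h).symm⟩
  · rintro ⟨a, rfl⟩
    rw [Matrix.mulVec_smul, gR_mem, smul_zero]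

theorem ker_even_span (R : Type*) [CommRing R] (m : ℕ) (hm : m % 2 = 0) :
    LinearMap.ker (Matrix.mulVecLin ((BD (m + 4)).map ((↑) : ℤ → R))) =
      Submodule.span R (Set.range ![gR R m, hR R m]) := by
  ext v
  rw [LinearMap.mem_ker, Matrix.mulVecLin_apply, Matrix.range_cons_cons_empty,
    Submodule.mem_span_pair]
  constructor
  · intro h
    exact ⟨_, _, ker_even m hm v h⟩
  · rintro ⟨a, b, rfl⟩
    rw [Matrix.mulVec_add, Matrix.mulVec_smul, Matrix.mulVec_smul, gR_mem, hR_mem _ _ hm]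
    simp

theorem gR_ne (R : Type*) [CommRing R] [Nontrivial R] (m : ℕ) : gR R m ≠ 0 := by
  intro h
  have := congrFun h ⟨m + 2, by omega⟩
  simp [gR] at this

theorem indep (m : ℕ) : LinearIndependent ℚ ![gR ℚ m, hR ℚ m] := by
  rw [LinearIndependent.pair_iff]
  intro s t h
  have e1 := congrFun h ⟨m + 2, by omega⟩
  have e2 := congrFun h ⟨0, by omega⟩
  simp [gR, hR] at e1 e2
  exact ⟨e1, e2⟩

/-- for `n ≥ 4`, the rank of `B(D_n)` over ℚ is `n - 1` for `n` odd and
`n - 2` for `n` even; moreover for `n` odd, the ℤ-submodule `{v ∈ ℤ^n : B(D_n) v = 0}` is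
free of rank 1, generated by `(0, …, 0, 1, -1)`. -/
theorem rank_and_ker_BD (n : ℕ) (hn : 4 ≤ n) :
    ((BD n).map ((↑) : ℤ → ℚ)).rank = (if n % 2 = 1 then n - 1 else n - 2) ∧
    (n % 2 = 1 →
      gD n ≠ 0 ∧
      LinearMap.ker (Matrix.mulVecLin (BD n)) = Submodule.span ℤ {gD n}) := by
  obtain ⟨m, rfl⟩ : ∃ m, n = m + 4 := ⟨n - 4, by omega⟩
  constructor
  · have rn := LinearMap.finrank_range_add_finrank_ker
      (Matrix.mulVecLin ((BD (m + 4)).map ((↑) : ℤ → ℚ)))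
    rw [Module.finrank_fin_fun] at rn
    rw [Matrix.rank]
    split_ifs with h
    · rw [ker_odd_span ℚ m (by omega), finrank_span_singleton (gR_ne ℚ m)] at rn
      omega
    · rw [ker_even_span ℚ m (by omega), finrank_span_eq_card (indep m)] at rn
      simp only [Fintype.card_fin] at rn
      omega
  · intro h
    rw [gD_eq]
    refine ⟨gR_ne ℤ m, ?_⟩
    have := ker_odd_span ℤ m (by omega)
    rw [← this]
    congr 2
end

section
/- Let n ≥ 5 be odd and let G = (0, …, 0, 1, −1) ∈ ℤ^n. Let Φ ⊆ ℤ^n be the set of almost positive roots of type D_n in simple-root coordinates: Φ = {−e_i : 1 ≤ i ≤ n} ∪ {e_i + ⋯ + e_{j−1} : 1 ≤ i < j ≤ n} ∪ {e_i + ⋯ + e_{n−2} + e_n : 1 ≤ i ≤ n−1} ∪ {e_i + ⋯ + e_{n−2} + e_{n−1} + e_n : 1 ≤ i ≤ n−2} ∪ {e_i + ⋯ + e_{j−1} + 2e_j + ⋯ + 2e_{n−2} + e_{n−1} + e_n : 1 ≤ i < j ≤ n−2}, and for α ∈ Φ set d(α) = −Σ_{l=1}^n α_l·G_l = α_n − α_{n−1}.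 Then d(α) ∈ {−1, 0, 1} for every α ∈ Φ, and the number of α ∈ Φ with d(α) = 1 is n, with d(α) = 0 is n(n−2), and with d(α) = −1 is n. In particular this grading of the coefficient-free type D_n cluster algebra is balanced. -/
open Matrix

/-- The positive root `e_i + ⋯ + e_{j-1}` (0-based half-open interval, pairs `i < j`). -/
def intRootCO {n : ℕ} (i j : Fin n) : Fin n → ℤ := fun l => if i ≤ l ∧ l < j then 1 else 0

/-- The positive root `e_i + ⋯ + e_{n-2} + e_n` of type `D_n` (1-based, `i ≤ n-1`). -/
def rootD3 (n : ℕ) (i : Fin n) : Fin n → ℤ := fun l =>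
  if (i ≤ l ∧ (l : ℕ) ≤ n - 3) ∨ (l : ℕ) = n - 1 then 1 else 0

/-- The positive root `e_i + ⋯ + e_{n-2} + e_{n-1} + e_n` of type `D_n` (1-based,
`i ≤ n-2`). -/
def rootD4 {n : ℕ} (i : Fin n) : Fin n → ℤ := fun l => if i ≤ l then 1 else 0

/-- The positive root `e_i + ⋯ + e_{j-1} + 2e_j + ⋯ + 2e_{n-2} + e_{n-1} + e_n` of type
`D_n` (1-based, `i < j ≤ n-2`), written for 0-based pairs `i < j` with `j ≤ n-3`. -/
def rootD5 (n : ℕ) (i j : Fin n) : Fin n → ℤ := fun l =>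
  if i ≤ l ∧ l < j then 1
  else if j ≤ l ∧ (l : ℕ) ≤ n - 3 then 2
  else if n - 2 ≤ (l : ℕ) then 1
  else 0

/-- The almost positive roots of type `D_n` in simple-root coordinates. -/
def PhiD (n : ℕ) : Finset (Fin n → ℤ) :=
  (Finset.univ.image negRoot) ∪
    (((Finset.univ ×ˢ Finset.univ).filter (fun p : Fin n × Fin n => p.1 < p.2)).image
      (fun p => intRootCO p.1 p.2)) ∪
    ((Finset.univ.filter (fun i : Fin n => (i : ℕ) ≤ n - 2)).image (rootD3 n)) ∪
    ((Finset.univ.filter (fun i : Fin n => (i : ℕ) ≤ n - 3)).image rootD4) ∪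
    (((Finset.univ ×ˢ Finset.univ).filter
        (fun p : Fin n × Fin n => p.1 < p.2 ∧ (p.2 : ℕ) ≤ n - 3)).image
      (fun p => rootD5 n p.1 p.2))

/-- The degree `d(α) = -∑ l, α_l G_l` (which equals `α_n - α_{n-1}` in 1-based terms). -/
def degD (n : ℕ) (α : Fin n → ℤ) : ℤ := -∑ l, α l * gD n l


/-- Parametrization of the degree-zero roots by `i ≤ n-3` and arbitrary `j`. -/
def auxF (n : ℕ) (i j : Fin n) : Fin n → ℤ :=
  if j < i then rootD5 n j i
  else if j = i then negRoot i
  else if (j : ℕ) ≤ n - 2 then intRootCO i j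
  else rootD4 i

/-- Parametrization of the degree-one roots. -/
def auxG (n : ℕ) (h : 5 ≤ n) (i : Fin n) : Fin n → ℤ :=
  if (i : ℕ) = n - 1 then negRoot ⟨n - 2, by omega⟩ else rootD3 n i

/-- Parametrization of the roots of degree minus one. -/
def auxH (n : ℕ) (h : 5 ≤ n) (i : Fin n) : Fin n → ℤ :=
  if (i : ℕ) = n - 1 then negRoot i else intRootCO i ⟨n - 1, by omega⟩

lemma degD_eq (n : ℕ) (h : 5 ≤ n) (α : Fin n → ℤ) :
    degD n α = α ⟨n - 1, by omega⟩ - α ⟨n - 2, by omega⟩ := by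
  have e : ∀ l : Fin n, α l * gD n l =
      (if l = ⟨n - 2, by omega⟩ then α l else 0) - (if l = ⟨n - 1, by omega⟩ then α l else 0) := by
    intro l
    simp only [gD, Fin.ext_iff]
    split_ifs <;> first | omega | simp
  simp only [degD, e, Finset.sum_sub_distrib, Finset.sum_ite_eq', Finset.mem_univ, if_true]
  ring

lemma degF (n : ℕ) (h : 5 ≤ n) (i j : Fin n) (hi : (i : ℕ) ≤ n - 3) : degD n (auxF n i j) = 0 := by
  rw [degD_eq n h]
  obtain ⟨i, hi'⟩ := i
  obtain ⟨j, hj'⟩ := j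
  simp only [auxF] at *
  split_ifs <;> simp only [rootD5, negRoot, intRootCO, rootD4, Fin.ext_iff, Fin.le_def, Fin.lt_def] at * <;> 
    split_ifs <;> omega

lemma degG (n : ℕ) (h : 5 ≤ n) (i : Fin n) : degD n (auxG n h i) = 1 := by
  rw [degD_eq n h]
  obtain ⟨i, hi'⟩ := i
  simp only [auxG] at *
  split_ifs <;> simp only [rootD3, negRoot, Fin.ext_iff, Fin.le_def] at * <;> 
    grind

lemma degH (n : ℕ) (h : 5 ≤ n) (i : Fin n) : degD n (auxH n h i) = -1 := by
  rw [degD_eq n h]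
  obtain ⟨i, hi'⟩ := i
  simp only [auxH] at *
  split_ifs <;> simp only [intRootCO, negRoot, Fin.ext_iff, Fin.le_def, Fin.lt_def] at * <;> 
    split_ifs <;> omega

lemma injF (n : ℕ) (h : 5 ≤ n) (i j i' j' : Fin n) (hi : (i : ℕ) ≤ n - 3) (hi2 : (i' : ℕ) ≤ n - 3)
    (e : auxF n i j = auxF n i' j') : i = i' ∧ j = j' := by
  have h1 := congrFun e i
  have h2 := congrFun e j
  have h3 := congrFun e i'
  have h4 := congrFun e j'
  have h5 := congrFun e ⟨n - 1, by omega⟩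
  clear e
  obtain ⟨i, _⟩ := i
  obtain ⟨j, _⟩ := j
  obtain ⟨i', _⟩ := i'
  obtain ⟨j', _⟩ := j'
  simp only [auxF] at *
  split_ifs at * <;>
    simp only [rootD5, negRoot, intRootCO, rootD4, Fin.ext_iff, Fin.le_def, Fin.lt_def] at * <;>
    grind

lemma injG (n : ℕ) (h : 5 ≤ n) : Function.Injective (auxG n h) := by
  intro i i' e
  have h1 := congrFun e i
  have h3 := congrFun e i'
  have h5 := congrFun e ⟨n - 1, by omega⟩
  clear e
  obtain ⟨i, _⟩ := i
  obtain ⟨i', _⟩ := i'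
  simp only [auxG] at *
  split_ifs at * <;>
    simp only [rootD3, negRoot, Fin.ext_iff, Fin.le_def, Fin.lt_def] at * <;>
    grind

lemma injH (n : ℕ) (h : 5 ≤ n) : Function.Injective (auxH n h) := by
  intro i i' e
  have h1 := congrFun e i
  have h3 := congrFun e i'
  clear e
  obtain ⟨i, _⟩ := i
  obtain ⟨i', _⟩ := i'
  simp only [auxH] at *
  split_ifs at * <;>
    simp only [intRootCO, negRoot, Fin.ext_iff, Fin.le_def, Fin.lt_def] at * <;>
    grind

lemma mem_PhiD (n : ℕ) (α : Fin n → ℤ) : α ∈ PhiD n ↔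
    (∃ i, negRoot i = α) ∨ (∃ i j : Fin n, i < j ∧ intRootCO i j = α) ∨
    (∃ i : Fin n, (i : ℕ) ≤ n - 2 ∧ rootD3 n i = α) ∨
    (∃ i : Fin n, (i : ℕ) ≤ n - 3 ∧ rootD4 i = α) ∨
    (∃ i j : Fin n, (i < j ∧ (j : ℕ) ≤ n - 3) ∧ rootD5 n i j = α) := by
  simp only [PhiD, Finset.mem_union, Finset.mem_image, Finset.mem_filter, Finset.mem_univ, true_and,
    Finset.mem_product, Prod.exists, or_assoc]

lemma mem_PhiD' (n : ℕ) (h : 5 ≤ n) (α : Fin n → ℤ) : α ∈ PhiD n ↔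
    (∃ i j : Fin n, (i : ℕ) ≤ n - 3 ∧ auxF n i j = α) ∨ (∃ i, auxG n h i = α) ∨
    (∃ i, auxH n h i = α) := by
  rw [mem_PhiD]
  constructor
  · rintro (⟨i, rfl⟩ | ⟨i, j, hij, rfl⟩ | ⟨i, hi, rfl⟩ | ⟨i, hi, rfl⟩ | ⟨i, j, ⟨hij, hj⟩, rfl⟩)
    · by_cases h1 : (i : ℕ) ≤ n - 3
      · exact Or.inl ⟨i, i, h1, by simp [auxF]⟩
      · by_cases h2 : (i : ℕ) = n - 1
        · exact Or.inr (Or.inr ⟨i, by simp [auxH, h2]⟩)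
        · refine Or.inr (Or.inl ⟨⟨n - 1, by omega⟩, ?_⟩)
          simp only [auxG, if_true]
          congr 1
          apply Fin.ext
          simp only
          omega
    · have := Fin.lt_def.1 hij
      by_cases h1 : (j : ℕ) = n - 1
      · refine Or.inr (Or.inr ⟨i, ?_⟩)
        rw [auxH, if_neg (by omega)]
        congr 1
        exact Fin.ext h1.symm
      · refine Or.inl ⟨i, j, by omega, ?_⟩
        rw [auxF, if_neg (by omega), if_neg (by omega), if_pos (by omega)]
    · refine Or.inr (Or.inl ⟨i, ?_⟩)
      rw [auxG, if_neg (by omega)]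
    · refine Or.inl ⟨i, ⟨n - 1, by omega⟩, hi, ?_⟩
      rw [auxF, if_neg (by simp only [Fin.lt_def]; omega), if_neg (by simp only [Fin.ext_iff]; omega),
        if_neg (by simp only; omega)]
    · refine Or.inl ⟨j, i, hj, ?_⟩
      rw [auxF, if_pos hij]
  · rintro (⟨i, j, hi, rfl⟩ | ⟨i, rfl⟩ | ⟨i, rfl⟩)
    · unfold auxF
      split_ifs with h1 h2 h3
      · exact Or.inr (Or.inr (Or.inr (Or.inr ⟨j, i, ⟨h1, hi⟩, rfl⟩)))
      · exact Or.inl ⟨i, rfl⟩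
      · exact Or.inr (Or.inl ⟨i, j, by omega, rfl⟩)
      · exact Or.inr (Or.inr (Or.inr (Or.inl ⟨i, hi, rfl⟩)))
    · unfold auxG
      split_ifs with h1
      · exact Or.inl ⟨_, rfl⟩
      · exact Or.inr (Or.inr (Or.inl ⟨i, by omega, rfl⟩))
    · unfold auxH
      split_ifs with h1
      · exact Or.inl ⟨_, rfl⟩
      · exact Or.inr (Or.inl ⟨i, _, by simp only [Fin.lt_def]; omega, rfl⟩)

/-- for odd `n ≥ 5`, all degrees lie in `{-1, 0, 1}`, with `n` almost
positive roots of degree `1`, `n(n-2)` of degree `0` and `n` of degree `-1`.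
In particular this grading of the coefficient-free type `D_n` cluster algebra is balanced. -/
theorem degree_distribution_D (n : ℕ) (hn5 : 5 ≤ n) (hn : n % 2 = 1) :
    (∀ α ∈ PhiD n, degD n α ∈ ({-1, 0, 1} : Set ℤ)) ∧
    ((PhiD n).filter (fun α => degD n α = 1)).card = n ∧
    ((PhiD n).filter (fun α => degD n α = 0)).card = n * (n - 2) ∧
    ((PhiD n).filter (fun α => degD n α = -1)).card = n := by
  refine ⟨?_, ?_, ?_, ?_⟩
  · intro α hα
    rcases (mem_PhiD' n hn5 α).1 hα with (⟨i, j, hi, rfl⟩ | ⟨i, rfl⟩ | ⟨i, rfl⟩)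
    · simp [degF n hn5 i j hi]
    · simp [degG]
    · simp [degH]
  · have : (PhiD n).filter (fun α => degD n α = 1) = Finset.univ.image (auxG n hn5) := by
      ext α
      simp only [Finset.mem_filter, mem_PhiD' n hn5, Finset.mem_image, Finset.mem_univ, true_and]
      constructor
      · rintro ⟨(⟨i, j, hi, rfl⟩ | ⟨i, rfl⟩ | ⟨i, rfl⟩), hd⟩
        · simp [degF n hn5 i j hi] at hd
        · exact ⟨i, rfl⟩
        · simp [degH] at hd
      · rintro ⟨i, rfl⟩
        exact ⟨Or.inr (Or.inl ⟨i, rfl⟩), degG n hn5 i⟩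
    rw [this, Finset.card_image_of_injective _ (injG n hn5), Finset.card_univ, Fintype.card_fin]
  · have : (PhiD n).filter (fun α => degD n α = 0) =
        (Finset.univ ×ˢ (Finset.univ : Finset (Fin (n - 2)))).image
          (fun p : Fin n × Fin (n - 2) => auxF n (Fin.castLE (by omega) p.2) p.1) := by
      ext α
      simp only [Finset.mem_filter, mem_PhiD' n hn5, Finset.mem_image, Finset.mem_univ, true_and,
        Finset.mem_product, Prod.exists]
      constructor
      · rintro ⟨(⟨i, j, hi, rfl⟩ | ⟨i, rfl⟩ | ⟨i, rfl⟩), hd⟩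
        · exact ⟨j, ⟨i, by omega⟩, rfl⟩
        · simp [degG] at hd
        · simp [degH] at hd
      · rintro ⟨j, i, rfl⟩
        have hi : ((Fin.castLE (by omega) i : Fin n) : ℕ) ≤ n - 3 := by
          simp only [Fin.val_castLE]; omega
        exact ⟨Or.inl ⟨_, j, hi, rfl⟩, degF n hn5 _ j hi⟩
    rw [this, Finset.card_image_of_injective, Finset.card_product, Finset.card_univ,
      Finset.card_univ, Fintype.card_fin, Fintype.card_fin]
    rintro ⟨j, i⟩ ⟨j', i'⟩ e
    obtain ⟨h1, h2⟩ := injF n hn5 _ _ _ _ (by simp only [Fin.val_castLE]; omega)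
      (by simp only [Fin.val_castLE]; omega) e
    simp only [Fin.ext_iff, Fin.val_castLE] at h1 h2
    simp only [Prod.mk.injEq, Fin.ext_iff]
    exact ⟨h2, h1⟩
  · have : (PhiD n).filter (fun α => degD n α = -1) = Finset.univ.image (auxH n hn5) := by
      ext α
      simp only [Finset.mem_filter, mem_PhiD' n hn5, Finset.mem_image, Finset.mem_univ, true_and]
      constructor
      · rintro ⟨(⟨i, j, hi, rfl⟩ | ⟨i, rfl⟩ | ⟨i, rfl⟩), hd⟩
        · simp [degF n hn5 i j hi] at hd
        · simp [degG] at hd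
        · exact ⟨i, rfl⟩
      · rintro ⟨i, rfl⟩
        exact ⟨Or.inr (Or.inr ⟨i, rfl⟩), degH n hn5 i⟩
    rw [this, Finset.card_image_of_injective _ (injH n hn5), Finset.card_univ, Fintype.card_fin]
end
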